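/- arXiv:2605.26598 — 7 statements merged into one kernel-verified Lean document; each statement's English description precedes it below -/
import Mathlib

section
/- Let a/b < c/d be Farey adjacent fractions in lowest terms (a, c ∈ ℤ, b, d ∈ ℕ with b, d ≥ 1, gcd(a,b) = gcd(c,d) = 1, a*d − b*c = −1), and let p/q be a fraction in lowest terms with (a : ℚ)/b < (p : ℚ)/q < (c : ℚ)/d. Then p = (c*q − d*p)*a + (p*b − q*a)*c and q = (c*q − d*p)*b + (p*b − q*a)*d, where the integers c*q − d*p and p*b − q*a are both ≥ 1. In particular q ≥ b + d, so q > max(b, d). -/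
/-- Haros' proposition: if `a/b < c/d` are Farey adjacent fractions in lowest terms and
`p/q` is any fraction in lowest terms strictly between them, then
`(p, q) = (c*q - d*p)·(a, b) + (p*b - q*a)·(c, d)` with both coefficients positive integers;
in particular `q ≥ b + d > max(b, d)`. -/
theorem haros_decomposition (a c p : ℤ) (b d q : ℕ)
    (hb : 1 ≤ b) (hd : 1 ≤ d) (hq : 1 ≤ q)
    (hab : Int.gcd a b = 1) (hcd : Int.gcd c d = 1) (hpq : Int.gcd p q = 1)
    (hadj : a * (d : ℤ) - (b : ℤ) * c = -1)
    (h1 : (a : ℚ) / (b : ℚ) < (p : ℚ) / (q : ℚ))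
    (h2 : (p : ℚ) / (q : ℚ) < (c : ℚ) / (d : ℚ)) :
    p = (c * (q : ℤ) - (d : ℤ) * p) * a + (p * (b : ℤ) - (q : ℤ) * a) * c ∧
    (q : ℤ) = (c * (q : ℤ) - (d : ℤ) * p) * (b : ℤ) + (p * (b : ℤ) - (q : ℤ) * a) * (d : ℤ) ∧
    1 ≤ c * (q : ℤ) - (d : ℤ) * p ∧
    1 ≤ p * (b : ℤ) - (q : ℤ) * a ∧
    b + d ≤ q ∧
    max b d < q := by
  have hb' : (0 : ℚ) < b := by exact_mod_cast hb
  have hd' : (0 : ℚ) < d := by exact_mod_cast hd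
  have hq' : (0 : ℚ) < q := by exact_mod_cast hq
  rw [div_lt_div_iff₀ hb' hq'] at h1
  rw [div_lt_div_iff₀ hq' hd'] at h2
  have hleft : a * (q : ℤ) < p * (b : ℤ) := by exact_mod_cast h1
  have hright : p * (d : ℤ) < c * (q : ℤ) := by exact_mod_cast h2
  have hm : 1 ≤ c * (q : ℤ) - (d : ℤ) * p := by linarith
  have hn : 1 ≤ p * (b : ℤ) - (q : ℤ) * a := by linarith
  have hq_eq : (q : ℤ) =
      (c * (q : ℤ) - (d : ℤ) * p) * (b : ℤ) + (p * (b : ℤ) - (q : ℤ) * a) * (d : ℤ) := by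
    linear_combination (q : ℤ) * hadj
  have hmb := le_mul_of_one_le_left (Int.natCast_nonneg b) hm
  have hnd := le_mul_of_one_le_left (Int.natCast_nonneg d) hn
  have hsum : b + d ≤ q := by
    zify
    linarith
  exact ⟨by linear_combination p * hadj, hq_eq, hm, hn, hsum, by omega⟩
end

section
/- Let a/b < c/d be Farey adjacent fractions in lowest terms (a*d − b*c = −1). Then every fraction p/q in lowest terms with (a : ℚ)/b < (p : ℚ)/q < (c : ℚ)/d satisfies q ≥ b + d, and q = b + d holds if and only if p = a + c and q = b + d, i.e. exactly when p/q is the mediant (a+c)/(b+d). In particular, among all fractions strictly between a/b and c/d, the smallest possible denominator is b + d, attained uniquely by the mediant. -/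
/-- Between two Farey adjacent fractions `a/b < c/d` in lowest terms, every fraction
`p/q` in lowest terms has denominator `q ≥ b + d`, with equality exactly when `p/q`
is the mediant `(a+c)/(b+d)`: the mediant uniquely attains the smallest denominator. -/
theorem mediant_smallest_denominator (a c : ℤ) (b d : ℕ)
    (hb : 1 ≤ b) (hd : 1 ≤ d)
    (hab : Int.gcd a b = 1) (hcd : Int.gcd c d = 1)
    (hlt : (a : ℚ) / (b : ℚ) < (c : ℚ) / (d : ℚ))
    (hadj : a * (d : ℤ) - (b : ℤ) * c = -1) :
    ∀ (p : ℤ) (q : ℕ), 1 ≤ q → Int.gcd p q = 1 →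
      (a : ℚ) / (b : ℚ) < (p : ℚ) / (q : ℚ) →
      (p : ℚ) / (q : ℚ) < (c : ℚ) / (d : ℚ) →
      b + d ≤ q ∧ (q = b + d ↔ (p = a + c ∧ q = b + d)) := by
  intro p q hq _ hl hr
  have hb0 : (0 : ℚ) < b := by exact_mod_cast hb
  have hd0 : (0 : ℚ) < d := by exact_mod_cast hd
  have hq0 : (0 : ℚ) < q := by exact_mod_cast hq
  rw [div_lt_div_iff₀ hb0 hq0] at hl
  rw [div_lt_div_iff₀ hq0 hd0] at hr
  have hl' : a * q < p * b := by exact_mod_cast hl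
  have hr' : p * d < c * q := by exact_mod_cast hr
  obtain ⟨x, hx⟩ : ∃ x : ℤ, x = p * b - a * q := ⟨_, rfl⟩
  obtain ⟨y, hy⟩ : ∃ y : ℤ, y = c * q - p * d := ⟨_, rfl⟩
  have hx1 : 1 ≤ x := by omega
  have hy1 : 1 ≤ y := by omega
  have hb1 : (1 : ℤ) ≤ b := by exact_mod_cast hb
  have hd1 : (1 : ℤ) ≤ d := by exact_mod_cast hd
  have hqxy : (q : ℤ) = b * y + d * x := by
    subst hx hy; linear_combination (q : ℤ) * hadj
  have hpxy : p = a * y + c * x := by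
    subst hx hy; linear_combination p * hadj
  refine ⟨?_, fun h => ⟨?_, h⟩, And.right⟩
  · zify
    nlinarith
  · have hqbd : (q : ℤ) = b + d := by exact_mod_cast h
    have hx_eq : x = 1 := by nlinarith
    have hy_eq : y = 1 := by nlinarith
    rw [hpxy, hx_eq, hy_eq, mul_one, mul_one]
end

section
/- Let p ∈ ℤ and q ∈ ℕ with q ≥ 1 and gcd(p, q) = 1. Then there exist unique fractions a/b and c/d in lowest terms with (a : ℚ)/b < (p : ℚ)/q < (c : ℚ)/d such that both consecutive pairs are Farey adjacent (b*p − a*q = 1 and q*c − p*d = 1) and either q = b = d = 1 or q > max(b, d). Moreover, in the case q > 1 (so q > max(b, d)), the two parents a/b and c/d are Farey adjacent to each other, i.e. a*d − b*c = −1. -/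
/-- A Bézout pair for coprime `p, q` can be chosen with its coefficient of `p` in `[1, q]`. -/
theorem exists_bezout_coeff_le {p : ℤ} {q : ℕ} (hq : 1 ≤ q) (hpq : Int.gcd p q = 1) :
    ∃ (a : ℤ) (b : ℕ), 1 ≤ b ∧ b ≤ q ∧ (b : ℤ) * p - a * q = 1 := by
  have hbez := Int.gcd_eq_gcd_ab p q
  rw [hpq] at hbez
  set u := Int.gcdA p q
  set v := Int.gcdB p q
  have hq0 : (0 : ℤ) < q := by exact_mod_cast hq
  have hnonneg := Int.emod_nonneg (u - 1) hq0.ne'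
  have hlt := Int.emod_lt_of_pos (u - 1) hq0
  have hdiv := Int.emod_add_mul_ediv (u - 1) q
  refine ⟨-v - (u - 1) / q * p, ((u - 1) % q + 1).toNat, by omega, by omega, ?_⟩
  rw [Int.toNat_of_nonneg (by omega)]
  push_cast at hbez
  linear_combination p * hdiv - hbez

theorem lt_of_bezout_of_le {p a : ℤ} {q b : ℕ} (hq : 1 < q) (hb : b ≤ q)
    (h : (b : ℤ) * p - a * q = 1) : b < q := by
  refine lt_of_le_of_ne hb ?_
  rintro rfl
  have hdvd : (b : ℤ) ∣ 1 := ⟨p - a, by linear_combination -h⟩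
  have := Int.le_of_dvd one_pos hdvd
  omega

theorem bezout_unique_of_le {p a a' : ℤ} {q b b' : ℕ} (hb : 1 ≤ b) (hbq : b ≤ q)
    (hb' : 1 ≤ b') (hbq' : b' ≤ q) (h : (b : ℤ) * p - a * q = 1)
    (h' : (b' : ℤ) * p - a' * q = 1) : a = a' ∧ b = b' := by
  have hdvd : (q : ℤ) ∣ b - b' :=
    ⟨a * b' - a' * b, by linear_combination b' * h - b * h'⟩
  have hzero := Int.eq_zero_of_abs_lt_dvd hdvd (by rw [abs_lt]; constructor <;> omega)
  obtain rfl : b = b' := by omega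
  have hq0 : (q : ℤ) ≠ 0 := by omega
  exact ⟨mul_right_cancel₀ hq0 (by linear_combination h' - h), rfl⟩

theorem int_gcd_eq_one_of_bezout {a b x y : ℤ} (h : a * x + b * y = 1) : Int.gcd a b = 1 :=
  Int.isCoprime_iff_gcd_eq_one.mp ⟨x, y, by linear_combination h⟩

theorem div_lt_div_of_cross_sub_eq_one {a c : ℤ} {b d : ℕ} (hb : 1 ≤ b) (hd : 1 ≤ d)
    (h : (b : ℤ) * c - a * d = 1) : (a : ℚ) / b < (c : ℚ) / d := by
  rw [div_lt_div_iff₀ (by exact_mod_cast hb) (by exact_mod_cast hd)]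
  have : a * d < c * (b : ℤ) := by linarith
  exact_mod_cast this

theorem parents_adjacent {p a c : ℤ} {q b d : ℕ} (hb : 1 ≤ b) (hbq : b < q) (hdq : d < q)
    (hl : (b : ℤ) * p - a * q = 1) (hr : (q : ℤ) * c - p * d = 1) :
    a * (d : ℤ) - (b : ℤ) * c = -1 := by
  have hdvd : (q : ℤ) ∣ b + d - q :=
    ⟨b * c - a * d - 1, by linear_combination (-d : ℤ) * hl - b * hr⟩
  have hzero := Int.eq_zero_of_abs_lt_dvd hdvd (by rw [abs_lt]; constructor <;> omega)
  have hq0 : (q : ℤ) ≠ 0 := by omega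
  refine mul_left_cancel₀ hq0 ?_
  linear_combination (-d : ℤ) * hl - b * hr - hzero

/-- Every fraction `p/q` in lowest terms has unique Farey parents: fractions
`a/b < p/q < c/d` in lowest terms with `b*p - a*q = 1` and `q*c - p*d = 1`, such that
either `q = b = d = 1` or `q > max(b, d)`; and in the case `q > 1` the two parents are
Farey adjacent to each other. -/
theorem farey_parents (p : ℤ) (q : ℕ) (hq : 1 ≤ q) (hpq : Int.gcd p q = 1) :
    (∃! x : ℤ × ℕ × ℤ × ℕ,
      1 ≤ x.2.1 ∧ 1 ≤ x.2.2.2 ∧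
      Int.gcd x.1 x.2.1 = 1 ∧ Int.gcd x.2.2.1 x.2.2.2 = 1 ∧
      (x.1 : ℚ) / (x.2.1 : ℚ) < (p : ℚ) / (q : ℚ) ∧
      (p : ℚ) / (q : ℚ) < (x.2.2.1 : ℚ) / (x.2.2.2 : ℚ) ∧
      (x.2.1 : ℤ) * p - x.1 * (q : ℤ) = 1 ∧
      (q : ℤ) * x.2.2.1 - p * (x.2.2.2 : ℤ) = 1 ∧
      ((q = 1 ∧ x.2.1 = 1 ∧ x.2.2.2 = 1) ∨ max x.2.1 x.2.2.2 < q)) ∧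
    (∀ (a : ℤ) (b : ℕ) (c : ℤ) (d : ℕ),
      1 ≤ b → 1 ≤ d →
      Int.gcd a b = 1 → Int.gcd c d = 1 →
      (a : ℚ) / (b : ℚ) < (p : ℚ) / (q : ℚ) →
      (p : ℚ) / (q : ℚ) < (c : ℚ) / (d : ℚ) →
      (b : ℤ) * p - a * (q : ℤ) = 1 →
      (q : ℤ) * c - p * (d : ℤ) = 1 →
      ((q = 1 ∧ b = 1 ∧ d = 1) ∨ max b d < q) →
      1 < q →
      a * (d : ℤ) - (b : ℤ) * c = -1) := by
  constructor
  · obtain ⟨a, b, hb, hbq, hl⟩ := exists_bezout_coeff_le hq hpq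
    obtain ⟨c, d, hd, hdq, hr⟩ :=
      exists_bezout_coeff_le (p := -p) hq (by rwa [Int.neg_gcd])
    have hr' : (q : ℤ) * -c - p * d = 1 := by linear_combination hr
    refine ⟨(a, b, -c, d), ⟨hb, hd,
      int_gcd_eq_one_of_bezout (x := -q) (y := p) (by linear_combination hl),
      int_gcd_eq_one_of_bezout (x := q) (y := -p) (by linear_combination hr'),
      div_lt_div_of_cross_sub_eq_one hb hq hl,
      div_lt_div_of_cross_sub_eq_one hq hd hr', hl, hr', ?_⟩, ?_⟩
    · rcases hq.eq_or_lt with rfl | hq1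
      · exact Or.inl ⟨rfl, le_antisymm hbq hb, le_antisymm hdq hd⟩
      · exact Or.inr (max_lt (lt_of_bezout_of_le hq1 hbq hl) (lt_of_bezout_of_le hq1 hdq hr))
    · rintro ⟨a', b', c', d'⟩ ⟨hb', hd', -, -, -, -, hl', hr', hsize⟩
      dsimp only at hb' hd' hl' hr' hsize
      obtain ⟨rfl, rfl⟩ := bezout_unique_of_le hb' (by omega) hb hbq hl' hl
      obtain ⟨hc, rfl⟩ := bezout_unique_of_le (p := -p) (a := -c') hd' (by omega) hd hdq
        (by linear_combination hr') hr
      rw [← hc, neg_neg]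
  · intro a b c d hb _ _ _ _ _ hl hr hsize hq1
    exact parents_adjacent hb (by omega) (by omega) hl hr
end

section
/- Let a/b < c/d be fractions in lowest terms (a, c ∈ ℤ, b, d ∈ ℕ with b, d ≥ 1, gcd(a,b) = gcd(c,d) = 1). Then a*d − b*c = −1 (i.e. a/b and c/d are Farey adjacent) if and only if every fraction p/q in lowest terms with (a : ℚ)/b < (p : ℚ)/q < (c : ℚ)/d satisfies q > max(b, d). -/
/-- Comparison of two fractions with positive denominators by cross multiplication. -/
lemma intCast_div_natCast_lt_iff (a p : ℤ) (b q : ℕ) (hb : 1 ≤ b) (hq : 1 ≤ q) :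
    (a : ℚ) / (b : ℚ) < (p : ℚ) / (q : ℚ) ↔ a * (q : ℤ) < p * (b : ℤ) := by
  have hb' : (0 : ℚ) < b := by exact_mod_cast hb
  have hq' : (0 : ℚ) < q := by exact_mod_cast hq
  rw [div_lt_div_iff₀ hb' hq']
  exact_mod_cast Iff.rfl

/-- If `(b, a)` and `(d, c)` are primitive vectors of determinant at least `2`, some lattice point
`(q, p)` of determinant `1` with `(b, a)` lies in the open cone they span, inside the
parallelogram. -/
lemma exists_lattice_point_of_two_le_det {a b c d : ℤ} (hab : IsCoprime a b)
    (hcd : IsCoprime c d) (hdet : 2 ≤ b * c - a * d) :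
    ∃ p q : ℤ, p * b - a * q = 1 ∧ 0 < c * q - d * p ∧ c * q - d * p < b * c - a * d := by
  obtain ⟨u, v, huv⟩ := hab
  set k := b * c - a * d with hk
  set m := (c * -u - d * v) / k with hm
  have hmod : c * (-u - m * b) - d * (v - m * a) = (c * -u - d * v) % k := by
    rw [Int.emod_def, ← hm, hk]; ring
  have hone : (v - m * a) * b - a * (-u - m * b) = 1 := by linear_combination huv
  refine ⟨v - m * a, -u - m * b, hone, ?_, hmod ▸ Int.emod_lt_of_pos _ (by lia)⟩
  refine lt_of_le_of_ne (hmod ▸ Int.emod_nonneg _ (by lia)) fun hzero ↦ ?_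
  generalize v - m * a = p at hone hzero
  generalize -u - m * b = q at hone hzero
  have hdvd : k ∣ d := ⟨q, by rw [hk]; linear_combination (-d) * hone + b * hzero⟩
  have hdvd' : k ∣ c := ⟨p, by rw [hk]; linear_combination (-c) * hone + a * hzero⟩
  rcases Int.isUnit_iff.mp (hcd.isUnit_of_dvd' hdvd' hdvd) with h | h <;> lia

/-- Two fractions `a/b < c/d` in lowest terms are Farey adjacent if and only if every
fraction `p/q` in lowest terms strictly between them has a strictly larger denominator
`q > max(b, d)`. -/
theorem farey_adjacent_iff_larger_denominators (a c : ℤ) (b d : ℕ)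
    (hb : 1 ≤ b) (hd : 1 ≤ d)
    (hab : Int.gcd a b = 1) (hcd : Int.gcd c d = 1)
    (hlt : (a : ℚ) / (b : ℚ) < (c : ℚ) / (d : ℚ)) :
    a * (d : ℤ) - (b : ℤ) * c = -1 ↔
      ∀ (p : ℤ) (q : ℕ), 1 ≤ q → Int.gcd p q = 1 →
        (a : ℚ) / (b : ℚ) < (p : ℚ) / (q : ℚ) →
        (p : ℚ) / (q : ℚ) < (c : ℚ) / (d : ℚ) →
        max b d < q := by
  have hb' : (1 : ℤ) ≤ b := by exact_mod_cast hb
  have hd' : (1 : ℤ) ≤ d := by exact_mod_cast hd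
  rw [intCast_div_natCast_lt_iff _ _ _ _ hb hd] at hlt
  constructor
  · intro hdet p q hq _ hap hpc
    rw [intCast_div_natCast_lt_iff _ _ _ _ hb hq] at hap
    rw [intCast_div_natCast_lt_iff _ _ _ _ hq hd] at hpc
    have hsum : (q : ℤ) = b * (c * q - p * d) + d * (p * b - a * q) := by
      linear_combination (q : ℤ) * hdet
    have hle : (b : ℤ) + d ≤ q := by
      have h₁ : (b : ℤ) * 1 ≤ b * (c * q - p * d) := by gcongr; lia
      have h₂ : (d : ℤ) * 1 ≤ d * (p * b - a * q) := by gcongr; lia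
      lia
    lia
  · intro hlarge
    by_contra hdet
    have hk : 2 ≤ (b : ℤ) * c - a * d := by
      have := mul_comm (b : ℤ) c
      lia
    obtain ⟨p, q, hone, hpos, hltk⟩ := exists_lattice_point_of_two_le_det
      (Int.isCoprime_iff_gcd_eq_one.mpr hab) (Int.isCoprime_iff_gcd_eq_one.mpr hcd) hk
    have hsum : q * (b * c - a * d) = b * (c * q - d * p) + d := by
      linear_combination (d : ℤ) * hone
    have hq : 0 < q := by
      refine pos_of_mul_pos_left (b := (b : ℤ) * c - a * d) ?_ (by lia)
      rw [hsum]; positivity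
    lift q to ℕ using hq.le
    have hq' : 1 ≤ q := by exact_mod_cast hq
    have hmax := hlarge p q hq'
      (Int.isCoprime_iff_gcd_eq_one.mp ⟨b, -a, by linear_combination hone⟩)
      ((intCast_div_natCast_lt_iff _ _ _ _ hb hq').mpr (by lia))
      ((intCast_div_natCast_lt_iff _ _ _ _ hq' hd).mpr (by linarith [mul_comm p (d : ℤ)]))
    have hbq : (b : ℤ) < q := by lia
    have hdq : (d : ℤ) < q := by lia
    nlinarith
end

section
/- Let a/b < p/q < c/d be fractions in lowest terms with consecutive pairs Farey adjacent (a*q − b*p = −1 and p*d − q*c = −1), and suppose q ≥ b, q ≥ d and q > 1. Then in fact q > max(b, d); consequently a/b and c/d are Farey adjacent (a*d − b*c = −1) and p = a + c, q = b + d, i.e. p/q is the mediant of a/b and c/d. -/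
/-- If `a/b < p/q < c/d` is a Farey sequence in lowest terms and `q ≥ b`, `q ≥ d`,
`q > 1`, then in fact `q > max(b, d)`, so `a/b` and `c/d` are Farey adjacent and
`p/q` is their mediant: `p = a + c` and `q = b + d`. -/
theorem farey_middle_is_mediant (a p c : ℤ) (b q d : ℕ)
    (hb : 1 ≤ b) (hq : 1 ≤ q) (hd : 1 ≤ d)
    (hab : Int.gcd a b = 1) (hpq : Int.gcd p q = 1) (hcd : Int.gcd c d = 1)
    (h1 : (a : ℚ) / (b : ℚ) < (p : ℚ) / (q : ℚ))
    (h2 : (p : ℚ) / (q : ℚ) < (c : ℚ) / (d : ℚ))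
    (adj1 : a * (q : ℤ) - (b : ℤ) * p = -1)
    (adj2 : p * (d : ℤ) - (q : ℤ) * c = -1)
    (hqb : b ≤ q) (hqd : d ≤ q) (hq1 : 1 < q) :
    max b d < q ∧
    a * (d : ℤ) - (b : ℤ) * c = -1 ∧
    p = a + c ∧ q = b + d := by
  have hq0 : (0 : ℤ) < q := by exact_mod_cast hq
  have not_dvd_one : ¬ (q : ℤ) ∣ 1 := fun h => by
    have := Int.le_of_dvd one_pos h
    omega
  have hbq : b < q := lt_of_le_of_ne hqb fun h => not_dvd_one ⟨p - a, by
    subst h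
    linear_combination adj1⟩
  have hdq : d < q := lt_of_le_of_ne hqd fun h => not_dvd_one ⟨c - p, by
    subst h
    linear_combination adj2⟩
  have cross : p * ((b : ℤ) + d) = q * (a + c) := by linear_combination adj2 - adj1
  have hdvd : (q : ℤ) ∣ b + d :=
    (Int.isCoprime_iff_gcd_eq_one.mpr hpq).symm.dvd_of_dvd_mul_left ⟨a + c, cross⟩
  have hsum : (b : ℤ) + d = q := by
    obtain ⟨k, hk⟩ := hdvd
    have hk0 : 0 < k := pos_of_mul_pos_right (by omega : 0 < (q : ℤ) * k) hq0.le
    have hk2 : k < 2 := lt_of_mul_lt_mul_left (by omega : (q : ℤ) * k < q * 2) hq0.le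
    obtain rfl : k = 1 := by omega
    linarith
  have hp : p = a + c := mul_left_cancel₀ hq0.ne' (by rw [← cross, hsum, mul_comm])
  refine ⟨max_lt hbq hdq, ?_, hp, by omega⟩
  linear_combination adj1 + a * hsum + b * hp
end

section
/- Let K be a field that is complete with respect to a multiplicative non-Archimedean absolute value |·| (i.e. |x*y| = |x|*|y| and |x + y| ≤ max(|x|, |y|)). Let n ∈ ℕ with n ≥ 1 and |(n : K)| = 1, and let γ ∈ K with |γ| < 1. Then there exists a unique x ∈ K with |x − 1| < 1 and x^n = 1 + γ. -/
section Ultrametric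

variable {K : Type*} [NormedField K] [IsUltrametricDist K]

theorem norm_add_le_of_le_of_le {a b : K} {r : ℝ} (ha : ‖a‖ ≤ r) (hb : ‖b‖ ≤ r) :
    ‖a + b‖ ≤ r :=
  (IsUltrametricDist.norm_add_le_max a b).trans (max_le ha hb)

theorem norm_le_one_of_norm_sub_one_le {x : K} {r : ℝ} (hr : r ≤ 1) (hx : ‖x - 1‖ ≤ r) :
    ‖x‖ ≤ 1 := by
  simpa using norm_add_le_of_le_of_le (hx.trans hr) (norm_one (α := K)).le

theorem norm_pow_sub_one_le {x : K} {r : ℝ} (hr : r ≤ 1) (hx : ‖x - 1‖ ≤ r) (n : ℕ) :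
    ‖x ^ n - 1‖ ≤ r := by
  have hr0 : 0 ≤ r := (norm_nonneg _).trans hx
  induction n with
  | zero => simpa using hr0
  | succ n ih =>
    rw [show x ^ (n + 1) - 1 = x * (x ^ n - 1) + (x - 1) by ring]
    refine norm_add_le_of_le_of_le ?_ hx
    rw [norm_mul]
    exact (mul_le_of_le_one_left (norm_nonneg _) (norm_le_one_of_norm_sub_one_le hr hx)).trans ih

/-- On a ball of radius `r ≤ 1` around `1`, the map `x ↦ x ^ n` differs from `x ↦ n * x` by an
`r`-Lipschitz map. -/
theorem norm_pow_sub_pow_sub_natCast_mul_le {x y : K} {r : ℝ} (hr : r ≤ 1)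
    (hx : ‖x - 1‖ ≤ r) (hy : ‖y - 1‖ ≤ r) (n : ℕ) :
    ‖x ^ n - y ^ n - n * (x - y)‖ ≤ r * ‖x - y‖ := by
  have hr0 : 0 ≤ r := (norm_nonneg _).trans hx
  induction n with
  | zero => simpa using mul_nonneg hr0 (norm_nonneg (x - y))
  | succ n ih =>
    rw [show x ^ (n + 1) - y ^ (n + 1) - ((n + 1 : ℕ) : K) * (x - y) =
      x * (x ^ n - y ^ n - n * (x - y)) + (y ^ n - 1) * (x - y) + n * (x - 1) * (x - y) by
        push_cast; ring]
    refine norm_add_le_of_le_of_le (norm_add_le_of_le_of_le ?_ ?_) ?_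
    · rw [norm_mul]
      exact (mul_le_of_le_one_left (norm_nonneg _)
        (norm_le_one_of_norm_sub_one_le hr hx)).trans ih
    · rw [norm_mul]
      gcongr
      exact norm_pow_sub_one_le hr hy n
    · rw [norm_mul, norm_mul]
      gcongr
      exact (mul_le_of_le_one_left (norm_nonneg _)
        (IsUltrametricDist.norm_natCast_le_one K n)).trans hx

theorem eq_of_pow_eq_pow_of_norm_sub_one_lt {n : ℕ} (hn : ‖(n : K)‖ = 1) {x y : K}
    (hx : ‖x - 1‖ < 1) (hy : ‖y - 1‖ < 1) (hxy : x ^ n = y ^ n) : x = y := by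
  have h := norm_pow_sub_pow_sub_natCast_mul_le (max_lt hx hy).le
    (le_max_left _ _) (le_max_right _ _) n
  rw [hxy, sub_self, zero_sub, norm_neg, norm_mul, hn, one_mul] at h
  by_contra hne
  have hpos : 0 < ‖x - y‖ := norm_pos_iff.mpr (sub_ne_zero.mpr hne)
  exact h.not_gt (mul_lt_of_lt_one_left hpos (max_lt hx hy))

/-- The `n`-th root is the fixed point of the simplified Newton iteration
`x ↦ x - (x ^ n - (1 + γ)) / n` on the closed ball of radius `‖γ‖` around `1`. -/
theorem exists_pow_eq_one_add [CompleteSpace K] {n : ℕ} (hn : ‖(n : K)‖ = 1) {γ : K}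
    (hγ : ‖γ‖ < 1) : ∃ x : K, ‖x - 1‖ ≤ ‖γ‖ ∧ x ^ n = 1 + γ := by
  have hn0 : (n : K) ≠ 0 := norm_ne_zero_iff.mp (by simp [hn])
  let T : K → K := fun x => x - (x ^ n - (1 + γ)) / n
  let s : Set K := Metric.closedBall 1 ‖γ‖
  have hmem {x : K} : x ∈ s ↔ ‖x - 1‖ ≤ ‖γ‖ := by simp [s, dist_eq_norm]
  have hone : (1 : K) ∈ s := by simp [hmem]
  have hlip {x y : K} (hx : x ∈ s) (hy : y ∈ s) : ‖T x - T y‖ ≤ ‖γ‖ * ‖x - y‖ := by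
    have heq : T x - T y = -((x ^ n - y ^ n - n * (x - y)) / n) := by
      simp only [T]; field_simp; ring
    rw [heq, norm_neg, norm_div, hn, div_one]
    exact norm_pow_sub_pow_sub_natCast_mul_le hγ.le (hmem.mp hx) (hmem.mp hy) n
  have hmaps : Set.MapsTo T s s := fun x hx => by
    have hT : T 1 - 1 = γ / n := by simp only [T]; field_simp; ring
    rw [hmem, show T x - 1 = (T x - T 1) + (T 1 - 1) by ring]
    refine norm_add_le_of_le_of_le ((hlip hx hone).trans ?_) (by simp [hT, hn])
    exact mul_le_of_le_one_right (norm_nonneg _) ((hmem.mp hx).trans hγ.le)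
  have hcontr : ContractingWith ‖γ‖₊ (hmaps.restrict T s s) :=
    ⟨by exact_mod_cast hγ, LipschitzWith.of_dist_le_mul fun x y => by
      simpa [Subtype.dist_eq, dist_eq_norm] using hlip x.2 y.2⟩
  obtain ⟨x, hx, hfix, -⟩ := hcontr.exists_fixedPoint' Metric.isClosed_closedBall.isComplete
    hmaps hone (edist_ne_top _ _)
  refine ⟨x, hmem.mp hx, ?_⟩
  have h0 : (x ^ n - (1 + γ)) / n = 0 := sub_eq_self.mp hfix
  exact sub_eq_zero.mp ((div_eq_zero_iff.mp h0).resolve_right hn0)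

end Ultrametric

/-- In a complete non-Archimedean normed field in which `n` has norm `1`, every element
`1 + γ` with `|γ| < 1` has a unique `n`-th root `x` with `|x - 1| < 1`. -/
theorem nonarchimedean_nth_root (K : Type*) [NormedField K] [CompleteSpace K]
    (hna : IsNonarchimedean (fun x : K => ‖x‖))
    (n : ℕ) (hn : 1 ≤ n) (hnorm : ‖(n : K)‖ = 1)
    (γ : K) (hγ : ‖γ‖ < 1) :
    ∃! x : K, ‖x - 1‖ < 1 ∧ x ^ n = 1 + γ := by
  have : IsUltrametricDist K := IsUltrametricDist.isUltrametricDist_of_isNonarchimedean_norm hna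
  obtain ⟨x, hx, hxn⟩ := exists_pow_eq_one_add hnorm hγ
  exact ⟨x, ⟨hx.trans_lt hγ, hxn⟩, fun y ⟨hy, hyn⟩ =>
    eq_of_pow_eq_pow_of_norm_sub_one_lt hnorm hy (hx.trans_lt hγ) (hyn.trans hxn.symm)⟩
end

section
/- Let k be a field and let ω : ℕ+ → k satisfy ω(1) = 1 and ω(m*n)^m = ω(n) for all m, n ∈ ℕ+ (a sequence of roots of unity in k; note each ω(n) then satisfies ω(n)^n = 1, hence is a unit). Define a map Ω on the field of Hahn series over k with exponents in ℚ by (Ω f).coeff r = ω(r.den)^(r.num) * f.coeff r for every r ∈ ℚ, where r.num ∈ ℤ and r.den ∈ ℕ+ are the numerator and denominator of r in lowest terms and the power is a zpow. Then Ω is a well-defined ring automorphism of HahnSeries ℚ k: it is additive, multiplicative, bijective (with inverse given by the sequence n ↦ ω(n)⁻¹), it preserves the support of every Hahn series, and it fixes every Hahn series whose support is contained in ℤ. -/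
namespace HahnSeries

variable {Γ R : Type*}

/-- Rescale the coefficients of a Hahn series by a family of units. -/
def rescale [PartialOrder Γ] [CommSemiring R] (c : Γ → Rˣ) (f : HahnSeries Γ R) :
    HahnSeries Γ R where
  coeff r := c r * f.coeff r
  isPWO_support' := f.isPWO_support.mono fun r hr h => hr (by simp [h])

@[simp]
theorem coeff_rescale [PartialOrder Γ] [CommSemiring R] (c : Γ → Rˣ) (f : HahnSeries Γ R) (r : Γ) :
    (rescale c f).coeff r = c r * f.coeff r :=
  rfl

@[simp]
theorem support_rescale [PartialOrder Γ] [CommSemiring R] (c : Γ → Rˣ) (f : HahnSeries Γ R) :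
    (rescale c f).support = f.support := by
  ext r
  simp

/-- The ring automorphism of Hahn series that rescales coefficients by a character of the
exponent group. -/
def rescaleEquiv [AddCommMonoid Γ] [PartialOrder Γ] [IsOrderedCancelAddMonoid Γ] [CommSemiring R]
    (χ : Multiplicative Γ →* Rˣ) : HahnSeries Γ R ≃+* HahnSeries Γ R where
  toFun := rescale fun r => χ (.ofAdd r)
  invFun := rescale fun r => (χ (.ofAdd r))⁻¹
  left_inv f := by
    ext r
    simp
  right_inv f := by
    ext r
    simp
  map_add' f g := by
    ext r
    simp [mul_add]
  map_mul' f g := by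
    ext r
    simp only [coeff_rescale, coeff_mul, support_rescale, Finset.mul_sum]
    refine Finset.sum_congr rfl fun ij hij => ?_
    rw [← (Finset.mem_antidiagonal.mp hij).2.2, ofAdd_add, map_mul, Units.val_mul]
    ring

end HahnSeries

section RootsOfUnity

variable {k : Type*} [Field k] {ω : ℕ+ → k}

theorem seqOfRootsOfUnity_ne_zero (hω1 : ω 1 = 1)
    (hω : ∀ m n : ℕ+, ω (m * n) ^ (m : ℕ) = ω n) (n : ℕ+) : ω n ≠ 0 := by
  intro h
  have := hω n 1
  rw [mul_one, h, hω1, zero_pow n.ne_zero] at this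
  exact zero_ne_one this

/-- The value `ω n ^ a` depends only on the fraction `a / n`. -/
theorem seqOfRootsOfUnity_zpow_eq (hω : ∀ m n : ℕ+, ω (m * n) ^ (m : ℕ) = ω n)
    {r : ℚ} {a : ℤ} {n : ℕ+} (hr : r = a / (n : ℕ)) :
    ω ⟨r.den, r.pos⟩ ^ r.num = ω n ^ a := by
  obtain ⟨c, ha, hn⟩ := Rat.num_den_mk (q := r) (n := a) (d := (n : ℕ))
    (by exact_mod_cast n.ne_zero) (by rw [hr, Rat.divInt_eq_div]; simp)
  have hc : 0 < c := by
    have hn_pos : (0 : ℤ) < (n : ℕ) := by exact_mod_cast n.pos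
    have hd_pos : (0 : ℤ) < r.den := by exact_mod_cast r.pos
    exact pos_of_mul_pos_left (hn ▸ hn_pos) hd_pos.le
  lift c to ℕ using hc.le
  obtain rfl : n = ⟨c, by exact_mod_cast hc⟩ * ⟨r.den, r.pos⟩ :=
    PNat.eq (show (n : ℕ) = c * r.den by exact_mod_cast hn)
  rw [ha, zpow_mul, zpow_natCast, ← hω ⟨c, by exact_mod_cast hc⟩ ⟨r.den, r.pos⟩]
  rfl

/-- The character `r ↦ ω r.den ^ r.num` of `ℚ` attached to a sequence of roots of unity `ω`. -/
def seqOfRootsOfUnityCharacter (hω1 : ω 1 = 1)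
    (hω : ∀ m n : ℕ+, ω (m * n) ^ (m : ℕ) = ω n) : Multiplicative ℚ →* kˣ where
  toFun r := Units.mk0 (ω ⟨r.toAdd.den, r.toAdd.pos⟩) (seqOfRootsOfUnity_ne_zero hω1 hω _) ^
    r.toAdd.num
  map_one' := by simp
  map_mul' r s := by
    obtain ⟨r, rfl⟩ := Multiplicative.ofAdd.surjective r
    obtain ⟨s, rfl⟩ := Multiplicative.ofAdd.surjective s
    ext
    simp only [toAdd_mul, toAdd_ofAdd, Units.val_mul, Units.val_zpow_eq_zpow_val, Units.val_mk0]
    let m : ℕ+ := ⟨r.den, r.pos⟩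
    let n : ℕ+ := ⟨s.den, s.pos⟩
    have hmn : ((m * n : ℕ+) : ℕ) = r.den * s.den := rfl
    have hr : r = (r.num * s.den : ℤ) / ((m * n : ℕ+) : ℕ) := by
      have := r.den_ne_zero
      have := s.den_ne_zero
      nth_rewrite 1 [← Rat.num_div_den r]
      rw [hmn]
      push_cast
      field_simp
    have hs : s = (s.num * r.den : ℤ) / ((m * n : ℕ+) : ℕ) := by
      have := r.den_ne_zero
      have := s.den_ne_zero
      nth_rewrite 1 [← Rat.num_div_den s]
      rw [hmn]
      push_cast
      field_simp
    have hrs : r + s = (r.num * s.den + s.num * r.den : ℤ) / ((m * n : ℕ+) : ℕ) := by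
      rw [Int.cast_add, add_div, ← hr, ← hs]
    rw [seqOfRootsOfUnity_zpow_eq hω hr, seqOfRootsOfUnity_zpow_eq hω hs,
      seqOfRootsOfUnity_zpow_eq hω hrs, zpow_add₀ (seqOfRootsOfUnity_ne_zero hω1 hω _)]

end RootsOfUnity

/-- A sequence of roots of unity `ω : ℕ+ → k` (i.e. `ω 1 = 1` and `ω(m*n)^m = ω(n)`)
induces a ring automorphism `Ω` of the Hahn series field `HahnSeries ℚ k`, acting on
coefficients by `(Ω f).coeff r = ω(r.den)^(r.num) * f.coeff r`; its inverse is the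
automorphism induced by `n ↦ (ω n)⁻¹`, it preserves the support of every Hahn series,
and it fixes every Hahn series whose support is contained in `ℤ ⊆ ℚ`. -/
theorem seqOfRootsOfUnity_induces_hahnSeries_automorphism
    (k : Type*) [Field k] (ω : ℕ+ → k)
    (hω1 : ω 1 = 1) (hω : ∀ m n : ℕ+, ω (m * n) ^ (m : ℕ) = ω n) :
    ∃ Ω : HahnSeries ℚ k ≃+* HahnSeries ℚ k,
      (∀ (f : HahnSeries ℚ k) (r : ℚ),
        (Ω f).coeff r = ω ⟨r.den, r.pos⟩ ^ r.num * f.coeff r) ∧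
      (∀ (f : HahnSeries ℚ k) (r : ℚ),
        (Ω.symm f).coeff r = (ω ⟨r.den, r.pos⟩)⁻¹ ^ r.num * f.coeff r) ∧
      (∀ f : HahnSeries ℚ k, (Ω f).support = f.support) ∧
      (∀ f : HahnSeries ℚ k,
        f.support ⊆ Set.range ((↑) : ℤ → ℚ) → Ω f = f) := by
  refine ⟨HahnSeries.rescaleEquiv (seqOfRootsOfUnityCharacter hω1 hω), fun f r => ?_,
    fun f r => ?_, fun f => HahnSeries.support_rescale _ f, fun f hf => ?_⟩
  · simp [HahnSeries.rescaleEquiv, seqOfRootsOfUnityCharacter]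
  · simp [HahnSeries.rescaleEquiv, seqOfRootsOfUnityCharacter]
  · ext r
    by_cases hr : f.coeff r = 0
    · simp [HahnSeries.rescaleEquiv, hr]
    · obtain ⟨z, rfl⟩ := hf hr
      simp [HahnSeries.rescaleEquiv, seqOfRootsOfUnityCharacter, hω1]
end
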